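/- arXiv:2108.01611 — 2 statements merged into one kernel-verified Lean document; each statement's English description precedes it below -/
import Mathlib

section
/- Let K = (K_n)_{n≥1} be a matrix convex set in V and let F be a convex subset of K_r. Suppose there exists a surjective complex r × n matrix γ with tr(γ*γ) = 1 such that F_γ := {(γ*γ, γ*Aγ) : A ∈ F} is an exposed face of the convex set Γ_n(K) ⊆ M_n(ℂ) × M_n(V). Then F is a weak matrix exposed face of K. -/
open scoped Matrix Kronecker ComplexOrder

noncomputable section

variable {V : Type*} [AddCommGroup V] [Module ℂ V]

/-- The matrix `γ* A γ` computed entrywise via the `ℂ`-action on `V`. -/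
def mconj {m n : ℕ} (γ : Matrix (Fin m) (Fin n) ℂ)
    (A : Matrix (Fin m) (Fin m) V) : Matrix (Fin n) (Fin n) V :=
  Matrix.of fun i j => ∑ k, ∑ l, (star (γ k i) * γ l j) • A k l

/-- A graded family `K = (K_n)` is a matrix convex set. -/
def IsMatrixConvex (K : ∀ n : ℕ, Set (Matrix (Fin n) (Fin n) V)) : Prop :=
  ∀ (k n : ℕ), 0 < k → 0 < n →
    ∀ (ns : Fin k → ℕ) (A : ∀ i : Fin k, Matrix (Fin (ns i)) (Fin (ns i)) V)
      (γ : ∀ i : Fin k, Matrix (Fin (ns i)) (Fin n) ℂ),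
      (∀ i, 0 < ns i) → (∀ i, A i ∈ K (ns i)) →
      (∑ i, (γ i)ᴴ * γ i) = 1 →
      (∑ i, mconj (γ i) (A i)) ∈ K n

/-- The `r`-th ampliation of `Φ : V → M_m(ℂ)` applied to `B ∈ M_r(V)`, as a matrix
indexed by `Fin m × Fin r` (block `(i,j)`, inner indices `(p,q)` ↦ `Φ (B i j) p q`). -/
def amplify {m r : ℕ} (Φ : V → Matrix (Fin m) (Fin m) ℂ)
    (B : Matrix (Fin r) (Fin r) V) : Matrix (Fin m × Fin r) (Fin m × Fin r) ℂ :=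
  Matrix.of fun p q => Φ (B p.2 q.2) p.1 q.1

/-- Hermitian part `(X + X*)/2` of a complex matrix. -/
def reM {ι : Type*} (X : Matrix ι ι ℂ) : Matrix ι ι ℂ := (2 : ℂ)⁻¹ • (X + Xᴴ)

section Top

variable [TopologicalSpace V]

/-- `(Φ, α)` matricially exposes the point `A ∈ K_n`. -/
def IsExposingPair (K : ∀ n : ℕ, Set (Matrix (Fin n) (Fin n) V)) {n : ℕ}
    (A : Matrix (Fin n) (Fin n) V)
    (Φ : V →L[ℂ] Matrix (Fin n) (Fin n) ℂ) (α : Matrix (Fin n) (Fin n) ℂ) : Prop :=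
  α.IsHermitian ∧
  (∀ r : ℕ, 0 < r → ∀ B ∈ K r,
    (α ⊗ₖ (1 : Matrix (Fin r) (Fin r) ℂ) - reM (amplify (⇑Φ) B)).PosSemidef) ∧
  {B | B ∈ K n ∧
      (α ⊗ₖ (1 : Matrix (Fin n) (Fin n) ℂ) - reM (amplify (⇑Φ) B)).PosSemidef ∧
      ¬ IsUnit (α ⊗ₖ (1 : Matrix (Fin n) (Fin n) ℂ) - reM (amplify (⇑Φ) B))} =
    {B | ∃ U ∈ Matrix.unitaryGroup (Fin n) ℂ, B = mconj U A}

/-- `A ∈ K_n` is a matrix exposed point of `K`. -/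
def IsMatrixExposed (K : ∀ n : ℕ, Set (Matrix (Fin n) (Fin n) V)) {n : ℕ}
    (A : Matrix (Fin n) (Fin n) V) : Prop :=
  ∃ (Φ : V →L[ℂ] Matrix (Fin n) (Fin n) ℂ) (α : Matrix (Fin n) (Fin n) ℂ),
    IsExposingPair K A Φ α

end Top

/-- Classical exposed point of a set in a topological `ℂ`-vector space. -/
def IsExposedPoint {W : Type*} [AddCommGroup W] [Module ℂ W] [TopologicalSpace W]
    (C : Set W) (x : W) : Prop :=
  x ∈ C ∧ ∃ (φ : W →L[ℂ] ℂ) (a : ℝ),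
    (φ x).re = a ∧ ∀ y ∈ C, y ≠ x → (φ y).re < a

/-- Classical exposed face of a set in a topological `ℂ`-vector space. -/
def IsExposedFaceOf {W : Type*} [AddCommGroup W] [Module ℂ W] [TopologicalSpace W]
    (C F : Set W) : Prop :=
  F ⊆ C ∧ ∃ (φ : W →L[ℂ] ℂ) (a : ℝ),
    (∀ x ∈ F, (φ x).re = a) ∧ ∀ y ∈ C, y ∉ F → (φ y).re < a

/-- `A ∈ K_n` is a matrix extreme point of the graded family `K`. -/
def IsMatrixExtreme (K : ∀ n : ℕ, Set (Matrix (Fin n) (Fin n) V)) {n : ℕ}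
    (A : Matrix (Fin n) (Fin n) V) : Prop :=
  A ∈ K n ∧
  ∀ (k : ℕ), 0 < k →
    ∀ (ns : Fin k → ℕ) (Ai : ∀ i : Fin k, Matrix (Fin (ns i)) (Fin (ns i)) V)
      (γ : ∀ i : Fin k, Matrix (Fin (ns i)) (Fin n) ℂ),
      (∀ i, 0 < ns i) → (∀ i, Ai i ∈ K (ns i)) →
      (∀ i, Function.Surjective (γ i).mulVec) →
      (∑ i, (γ i)ᴴ * γ i) = 1 →
      (∑ i, mconj (γ i) (Ai i)) = A →
      ∀ i, ∃ (h : ns i = n) (U : Matrix (Fin n) (Fin n) ℂ),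
        U ∈ Matrix.unitaryGroup (Fin n) ℂ ∧
        Matrix.reindex (finCongr h) (finCongr h) (Ai i) = mconj U A

/-- `Γ_n(K)`. -/
def GammaSet (K : ∀ n : ℕ, Set (Matrix (Fin n) (Fin n) V)) (n : ℕ) :
    Set (Matrix (Fin n) (Fin n) ℂ × Matrix (Fin n) (Fin n) V) :=
  {P | ∃ (k : ℕ), 0 < k ∧ ∃ (A : Matrix (Fin k) (Fin k) V) (γ : Matrix (Fin k) (Fin n) ℂ),
    A ∈ K k ∧ (γᴴ * γ).trace = 1 ∧ P = (γᴴ * γ, mconj γ A)}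

/-- Matrix face `F ⊆ K_n`. -/
def IsMatrixFace (K : ∀ n : ℕ, Set (Matrix (Fin n) (Fin n) V)) {n : ℕ}
    (F : Set (Matrix (Fin n) (Fin n) V)) : Prop :=
  F ⊆ K n ∧ Convex ℝ F ∧
  ∀ (k : ℕ), 0 < k →
    ∀ (ns : Fin k → ℕ) (Ai : ∀ i : Fin k, Matrix (Fin (ns i)) (Fin (ns i)) V)
      (γ : ∀ i : Fin k, Matrix (Fin (ns i)) (Fin n) ℂ),
      (∀ i, 0 < ns i) → (∀ i, Ai i ∈ K (ns i)) →
      (∀ i, Function.Surjective (γ i).mulVec) →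
      (∑ i, (γ i)ᴴ * γ i) = 1 →
      (∑ i, mconj (γ i) (Ai i)) ∈ F →
      ∀ i, ∃ h : ns i = n, Matrix.reindex (finCongr h) (finCongr h) (Ai i) ∈ F

/-- `A` is a `C*`-extreme point of `F ⊆ M_n(V)`. -/
def IsCStarExtreme {n : ℕ} (F : Set (Matrix (Fin n) (Fin n) V))
    (A : Matrix (Fin n) (Fin n) V) : Prop :=
  A ∈ F ∧
  ∀ (k : ℕ), 0 < k →
    ∀ (Ai : Fin k → Matrix (Fin n) (Fin n) V) (γ : Fin k → Matrix (Fin n) (Fin n) ℂ),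
      (∀ i, Ai i ∈ F) → (∀ i, IsUnit (γ i)) →
      (∑ i, (γ i)ᴴ * γ i) = 1 →
      (∑ i, mconj (γ i) (Ai i)) = A →
      ∀ i, ∃ U ∈ Matrix.unitaryGroup (Fin n) ℂ, Ai i = mconj U A

section Top2

variable [TopologicalSpace V]

/-- `(Φ, α)` is an exposing pair for the face `F ⊆ K_n`. -/
def IsFaceExposingPair (K : ∀ n : ℕ, Set (Matrix (Fin n) (Fin n) V)) {n : ℕ}
    (F : Set (Matrix (Fin n) (Fin n) V))
    (Φ : V →L[ℂ] Matrix (Fin n) (Fin n) ℂ) (α : Matrix (Fin n) (Fin n) ℂ) : Prop :=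
  α.IsHermitian ∧
  (∀ m : ℕ, 0 < m → ∀ B ∈ K m,
    (α ⊗ₖ (1 : Matrix (Fin m) (Fin m) ℂ) - reM (amplify (⇑Φ) B)).PosSemidef) ∧
  (∀ m : ℕ, 0 < m → m < n → ∀ B ∈ K m,
    (α ⊗ₖ (1 : Matrix (Fin m) (Fin m) ℂ) - reM (amplify (⇑Φ) B)).PosDef) ∧
  {B | B ∈ K n ∧
      (α ⊗ₖ (1 : Matrix (Fin n) (Fin n) ℂ) - reM (amplify (⇑Φ) B)).PosSemidef ∧
      ¬ IsUnit (α ⊗ₖ (1 : Matrix (Fin n) (Fin n) ℂ) - reM (amplify (⇑Φ) B))} = F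

/-- `F ⊆ K_n` is a matrix exposed face of `K`. -/
def IsMatrixExposedFace (K : ∀ n : ℕ, Set (Matrix (Fin n) (Fin n) V)) {n : ℕ}
    (F : Set (Matrix (Fin n) (Fin n) V)) : Prop :=
  F ⊆ K n ∧ Convex ℝ F ∧
  ∃ (Φ : V →L[ℂ] Matrix (Fin n) (Fin n) ℂ) (α : Matrix (Fin n) (Fin n) ℂ),
    IsFaceExposingPair K F Φ α

/-- The unitary orbit of `F ⊆ M_n(V)`. -/
def unitaryOrbit {n : ℕ} (F : Set (Matrix (Fin n) (Fin n) V)) :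
    Set (Matrix (Fin n) (Fin n) V) :=
  {B | ∃ A ∈ F, ∃ U ∈ Matrix.unitaryGroup (Fin n) ℂ, B = mconj U A}

/-- `F ⊆ K_n` is a weak matrix exposed face of `K`. -/
def IsWeakMatrixExposedFace (K : ∀ n : ℕ, Set (Matrix (Fin n) (Fin n) V)) {n : ℕ}
    (F : Set (Matrix (Fin n) (Fin n) V)) : Prop :=
  F ⊆ K n ∧ Convex ℝ F ∧
  ∃ (Φ : V →L[ℂ] Matrix (Fin n) (Fin n) ℂ) (α : Matrix (Fin n) (Fin n) ℂ),
    α.IsHermitian ∧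
    (∀ m : ℕ, 0 < m → ∀ B ∈ K m,
      (α ⊗ₖ (1 : Matrix (Fin m) (Fin m) ℂ) - reM (amplify (⇑Φ) B)).PosSemidef) ∧
    (∀ m : ℕ, 0 < m → m < n → ∀ B ∈ K m,
      (α ⊗ₖ (1 : Matrix (Fin m) (Fin m) ℂ) - reM (amplify (⇑Φ) B)).PosDef) ∧
    {B | B ∈ K n ∧
        (α ⊗ₖ (1 : Matrix (Fin n) (Fin n) ℂ) - reM (amplify (⇑Φ) B)).PosSemidef ∧
        ¬ IsUnit (α ⊗ₖ (1 : Matrix (Fin n) (Fin n) ℂ) - reM (amplify (⇑Φ) B))} =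
      unitaryOrbit F

end Top2

/-- `F = (F_n)` is a matrix multiface of `K`. -/
def IsMatrixMultiface (K F : ∀ n : ℕ, Set (Matrix (Fin n) (Fin n) V)) : Prop :=
  (∀ n, F n ⊆ K n) ∧ (∀ n, Convex ℝ (F n)) ∧
  ∀ (k n : ℕ), 0 < k → 0 < n →
    ∀ (ns : Fin k → ℕ) (Ai : ∀ i : Fin k, Matrix (Fin (ns i)) (Fin (ns i)) V)
      (γ : ∀ i : Fin k, Matrix (Fin (ns i)) (Fin n) ℂ),
      (∀ i, 0 < ns i) → (∀ i, Ai i ∈ K (ns i)) →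
      (∀ i, Function.Surjective (γ i).mulVec) →
      (∑ i, (γ i)ᴴ * γ i) = 1 →
      (∑ i, mconj (γ i) (Ai i)) ∈ F n →
      ∀ i, Ai i ∈ F (ns i)

section Top3

variable [TopologicalSpace V]

/-- `F = (F_n)` is a matrix exposed multiface of `K`. -/
def IsMatrixExposedMultiface (K F : ∀ n : ℕ, Set (Matrix (Fin n) (Fin n) V)) : Prop :=
  (∀ n, F n ⊆ K n) ∧ (∀ n, Convex ℝ (F n)) ∧
  ∃ (r : ℕ), 0 < r ∧
    ∃ (Φ : V →L[ℂ] Matrix (Fin r) (Fin r) ℂ) (α : Matrix (Fin r) (Fin r) ℂ),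
      α.IsHermitian ∧
      (∀ n : ℕ, 0 < n → ∀ B ∈ K n,
        (α ⊗ₖ (1 : Matrix (Fin n) (Fin n) ℂ) - reM (amplify (⇑Φ) B)).PosSemidef) ∧
      (∀ n : ℕ, 0 < n →
        {B | B ∈ K n ∧
            (α ⊗ₖ (1 : Matrix (Fin n) (Fin n) ℂ) - reM (amplify (⇑Φ) B)).PosSemidef ∧
            ¬ IsUnit (α ⊗ₖ (1 : Matrix (Fin n) (Fin n) ℂ) - reM (amplify (⇑Φ) B))} = F n)

end Top3

end

section Compression

variable {V : Type*} [AddCommGroup V] [Module ℂ V]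

lemma mconj_mconj {l m n : ℕ} (η : Matrix (Fin m) (Fin n) ℂ) (γ : Matrix (Fin l) (Fin m) ℂ)
    (A : Matrix (Fin l) (Fin l) V) : mconj η (mconj γ A) = mconj (γ * η) A := by
  ext i j
  simp only [mconj, Matrix.of_apply, Matrix.mul_apply, star_sum, star_mul', Finset.smul_sum,
    Finset.sum_mul_sum, Finset.sum_smul, smul_smul]
  simp only [← Fintype.sum_prod_type']
  refine Fintype.sum_equiv ⟨fun x => (x.2.2.1, x.2.2.2, x.1, x.2.1),
    fun x => (x.2.2.1, x.2.2.2, x.1, x.2.1), fun _ => rfl, fun _ => rfl⟩ _ _ fun x => ?_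
  simp only [Equiv.coe_fn_mk]
  congr 1
  ring

lemma mconj_one_left {n : ℕ} (A : Matrix (Fin n) (Fin n) V) : mconj 1 A = A := by
  ext i j
  simp [mconj, Matrix.one_apply, apply_ite star, ite_smul]

lemma mconj_zero_left {m n : ℕ} (A : Matrix (Fin m) (Fin m) V) :
    mconj (0 : Matrix (Fin m) (Fin n) ℂ) A = 0 := by
  ext i j
  simp [mconj]

lemma mconj_real_smul {m n : ℕ} (c : ℝ) (δ : Matrix (Fin m) (Fin n) ℂ)
    (A : Matrix (Fin m) (Fin m) V) : mconj ((c : ℂ) • δ) A = ((c : ℂ) ^ 2) • mconj δ A := by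
  ext i j
  simp only [mconj, Matrix.of_apply, Matrix.smul_apply, Finset.smul_sum, smul_smul]
  refine Finset.sum_congr rfl fun k _ => Finset.sum_congr rfl fun l _ => ?_
  congr 1
  simp
  ring

lemma mconj_matrix_one {m n : ℕ} (δ : Matrix (Fin m) (Fin n) ℂ) :
    mconj δ (1 : Matrix (Fin m) (Fin m) ℂ) = δᴴ * δ := by
  ext i j
  simp [mconj, Matrix.mul_apply, Matrix.one_apply]

/-- The linear map `v ↦ γ* (E_pq ⊗ v) γ`, where `E_pq` is a matrix unit. -/
def unitConj {r n : ℕ} (γ : Matrix (Fin r) (Fin n) ℂ) (p q : Fin r) :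
    V →ₗ[ℂ] Matrix (Fin n) (Fin n) V where
  toFun v := Matrix.of fun i j => (star (γ p i) * γ q j) • v
  map_add' v w := by ext; simp
  map_smul' c v := by ext; simp [smul_comm c]

/-- The compression along `γ` of a linear functional on `M_n(V)` to a map `V → M_r(ℂ)`. -/
def compress {r n : ℕ} (γ : Matrix (Fin r) (Fin n) ℂ) (f : Matrix (Fin n) (Fin n) V →ₗ[ℂ] ℂ) :
    V →ₗ[ℂ] Matrix (Fin r) (Fin r) ℂ where
  toFun v := Matrix.of fun p q => f (unitConj γ p q v)
  map_add' v w := by ext; simp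
  map_smul' c v := by ext; simp

lemma mconj_mul_eq_sum {m r n : ℕ} (ε : Matrix (Fin m) (Fin r) ℂ) (γ : Matrix (Fin r) (Fin n) ℂ)
    (A : Matrix (Fin m) (Fin m) V) :
    mconj (ε * γ) A = ∑ x : Fin r × Fin m, ∑ y : Fin r × Fin m,
      (star (ε x.2 x.1) * ε y.2 y.1) • unitConj γ x.1 y.1 (A x.2 y.2) := by
  ext i j
  simp only [mconj, unitConj, LinearMap.coe_mk, AddHom.coe_mk, Matrix.sum_apply, Matrix.smul_apply,
    Matrix.of_apply, Matrix.mul_apply, star_sum, star_mul', Finset.sum_mul_sum, Finset.sum_smul,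
    smul_smul]
  simp only [← Fintype.sum_prod_type']
  refine Fintype.sum_equiv ⟨fun x => ((x.2.2.1, x.1), (x.2.2.2, x.2.1)),
    fun x => (x.1.2, x.2.2, x.1.1, x.2.1), fun _ => rfl, fun _ => rfl⟩ _ _ fun x => ?_
  simp only [Equiv.coe_fn_mk]
  congr 1
  ring

lemma dotProduct_amplify_compress {m r n : ℕ} (γ : Matrix (Fin r) (Fin n) ℂ)
    (f : Matrix (Fin n) (Fin n) V →ₗ[ℂ] ℂ) (A : Matrix (Fin m) (Fin m) V)
    (x : Fin r × Fin m → ℂ) :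
    star x ⬝ᵥ (amplify (compress γ f) A *ᵥ x) =
      f (mconj ((Matrix.of fun k p => x (p, k)) * γ) A) := by
  rw [mconj_mul_eq_sum]
  simp only [map_sum, map_smul, dotProduct, Matrix.mulVec, Finset.mul_sum, amplify, compress,
    LinearMap.coe_mk, AddHom.coe_mk, Matrix.of_apply, Pi.star_apply, smul_eq_mul]
  refine Finset.sum_congr rfl fun y _ => Finset.sum_congr rfl fun z _ => ?_
  ring

lemma amplify_matrix_one {m r : ℕ} (Φ : ℂ →ₗ[ℂ] Matrix (Fin r) (Fin r) ℂ) :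
    amplify Φ (1 : Matrix (Fin m) (Fin m) ℂ) = Φ 1 ⊗ₖ (1 : Matrix (Fin m) (Fin m) ℂ) := by
  ext ⟨p, k⟩ ⟨q, l⟩
  by_cases h : k = l <;> simp [amplify, h]

lemma IsMatrixConvex.mconj_mem {K : ∀ n : ℕ, Set (Matrix (Fin n) (Fin n) V)}
    (hK : IsMatrixConvex K) {r : ℕ} (hr : 0 < r)
    {A : Matrix (Fin r) (Fin r) V} (hA : A ∈ K r) {U : Matrix (Fin r) (Fin r) ℂ}
    (hU : Uᴴ * U = 1) : mconj U A ∈ K r := by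
  simpa using hK 1 r one_pos hr (fun _ => r) (fun _ => A) (fun _ => U) (fun _ => hr)
    (fun _ => hA) (by simpa using hU)

end Compression

section HermitianPart

lemma reM_isHermitian {ι : Type*} (X : Matrix ι ι ℂ) : (reM X).IsHermitian := by
  ext i j
  simp [reM, mul_add, add_comm]

lemma reM_sub {ι : Type*} (X Y : Matrix ι ι ℂ) : reM (X - Y) = reM X - reM Y := by
  ext i j
  simp [reM]
  ring

lemma reM_kronecker_one {r m : ℕ} (X : Matrix (Fin r) (Fin r) ℂ) :
    reM (X ⊗ₖ (1 : Matrix (Fin m) (Fin m) ℂ)) = reM X ⊗ₖ (1 : Matrix (Fin m) (Fin m) ℂ) := by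
  ext ⟨p, k⟩ ⟨q, l⟩
  by_cases h : k = l
  · simp [reM, h, mul_add]
  · simp [reM, h, Ne.symm h]

lemma dotProduct_reM_mulVec {ι : Type*} [Fintype ι] (X : Matrix ι ι ℂ) (x : ι → ℂ) :
    star x ⬝ᵥ (reM X *ᵥ x) = ((star x ⬝ᵥ (X *ᵥ x)).re : ℂ) := by
  have h : star x ⬝ᵥ (Xᴴ *ᵥ x) = star (star x ⬝ᵥ (X *ᵥ x)) := by
    rw [Matrix.star_dotProduct, Matrix.star_mulVec, Matrix.conjTranspose_conjTranspose,
      ← Matrix.dotProduct_mulVec]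
  rw [reM, Matrix.smul_mulVec, Matrix.add_mulVec, dotProduct_smul, dotProduct_add, h,
    Complex.re_eq_add_conj]
  simp
  ring

end HermitianPart

section Exposure

lemma exists_real_smul_trace_eq_one {m n : ℕ} {δ : Matrix (Fin m) (Fin n) ℂ} (hδ : δ ≠ 0) :
    ∃ c : ℝ, c ≠ 0 ∧ ((((c : ℂ) • δ)ᴴ * ((c : ℂ) • δ)).trace = 1) := by
  have h0 : 0 ≤ (δᴴ * δ).trace := (Matrix.posSemidef_conjTranspose_mul_self δ).trace_nonneg
  have h1 : (δᴴ * δ).trace ≠ 0 := fun h => hδ (Matrix.trace_conjTranspose_mul_self_eq_zero_iff.1 h)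
  obtain ⟨t, ht⟩ : ∃ t : ℝ, (δᴴ * δ).trace = t :=
    ⟨_, Complex.ext rfl (by simpa using (Complex.le_def.1 h0).2.symm)⟩
  rw [ht] at h0 h1
  have ht0 : 0 < t := lt_of_le_of_ne (by exact_mod_cast h0) (by exact_mod_cast h1.symm)
  refine ⟨(√t)⁻¹, by positivity, ?_⟩
  rw [← mconj_matrix_one, mconj_real_smul, mconj_matrix_one, Matrix.trace_smul, ht, smul_eq_mul]
  norm_cast
  rw [inv_pow, Real.sq_sqrt ht0.le, inv_mul_cancel₀ ht0.ne']

lemma Matrix.PosSemidef.exists_dotProduct_mulVec_eq_zero {ι : Type*} [Fintype ι]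
    {M : Matrix ι ι ℂ} (hM : M.PosSemidef) (h : ¬ M.PosDef) :
    ∃ x, x ≠ 0 ∧ star x ⬝ᵥ (M *ᵥ x) = 0 := by
  by_contra! hx
  exact h (.of_dotProduct_mulVec_pos hM.isHermitian fun x h0 =>
    lt_of_le_of_ne (hM.dotProduct_mulVec_nonneg x) (hx x h0).symm)

variable {V : Type*} [AddCommGroup V] [Module ℂ V] [TopologicalSpace V]

lemma continuous_compress [ContinuousConstSMul ℂ V] {r n : ℕ} (γ : Matrix (Fin r) (Fin n) ℂ)
    {f : Matrix (Fin n) (Fin n) V →ₗ[ℂ] ℂ} (hf : Continuous f) : Continuous (compress γ f) := by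
  refine continuous_matrix fun p q => hf.comp (continuous_matrix fun i j => ?_)
  exact continuous_const_smul _

/-- `a tr(δ*δ) - φ(δ*δ, δ*Bδ)`. -/
noncomputable def gap {m n : ℕ} (φ : (Matrix (Fin n) (Fin n) ℂ × Matrix (Fin n) (Fin n) V) →L[ℂ] ℂ) (a : ℝ)
    (B : Matrix (Fin m) (Fin m) V) (δ : Matrix (Fin m) (Fin n) ℂ) : ℂ :=
  a * (δᴴ * δ).trace - φ (δᴴ * δ, mconj δ B)

variable {m n : ℕ} {φ : (Matrix (Fin n) (Fin n) ℂ × Matrix (Fin n) (Fin n) V) →L[ℂ] ℂ} {a : ℝ}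

lemma gap_real_smul (B : Matrix (Fin m) (Fin m) V) (δ : Matrix (Fin m) (Fin n) ℂ) (c : ℝ) :
    gap φ a B ((c : ℂ) • δ) = ((c ^ 2 : ℝ) : ℂ) * gap φ a B δ := by
  rw [gap, ← mconj_matrix_one, mconj_real_smul, mconj_real_smul, ← Prod.smul_mk, map_smul,
    Matrix.trace_smul, mconj_matrix_one, gap]
  simp only [smul_eq_mul, Complex.ofReal_pow]
  ring

variable {K : ∀ n : ℕ, Set (Matrix (Fin n) (Fin n) V)}
  {S : Set (Matrix (Fin n) (Fin n) ℂ × Matrix (Fin n) (Fin n) V)}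

lemma gap_re_nonneg (hS : ∀ x ∈ S, (φ x).re = a)
    (hK : ∀ y ∈ GammaSet K n, y ∉ S → (φ y).re < a) (hm : 0 < m)
    {B : Matrix (Fin m) (Fin m) V} (hB : B ∈ K m) (δ : Matrix (Fin m) (Fin n) ℂ) :
    0 ≤ (gap φ a B δ).re := by
  by_cases hδ : δ = 0
  · subst hδ
    simp [gap, mconj_zero_left, Prod.mk_zero_zero]
  obtain ⟨c, hc, htr⟩ := exists_real_smul_trace_eq_one hδ
  have h : 0 ≤ (gap φ a B ((c : ℂ) • δ)).re := by
    rw [gap, htr, mul_one, Complex.sub_re, Complex.ofReal_re, sub_nonneg]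
    by_cases hy : ((((c : ℂ) • δ)ᴴ * ((c : ℂ) • δ)), mconj ((c : ℂ) • δ) B) ∈ S
    · exact (hS _ hy).le
    · exact (hK _ ⟨m, hm, B, _, hB, htr, rfl⟩ hy).le
  rw [gap_real_smul, Complex.re_ofReal_mul] at h
  exact nonneg_of_mul_nonneg_right h (by positivity)

lemma exists_smul_mem_of_gap_re_eq_zero
    (hK : ∀ y ∈ GammaSet K n, y ∉ S → (φ y).re < a) (hm : 0 < m)
    {B : Matrix (Fin m) (Fin m) V} (hB : B ∈ K m) {δ : Matrix (Fin m) (Fin n) ℂ} (hδ : δ ≠ 0)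
    (h0 : (gap φ a B δ).re = 0) :
    ∃ c : ℂ, ((c • δ)ᴴ * (c • δ), mconj (c • δ) B) ∈ S := by
  obtain ⟨c, -, htr⟩ := exists_real_smul_trace_eq_one hδ
  refine ⟨c, by_contra fun hy => ?_⟩
  have h : (gap φ a B ((c : ℂ) • δ)).re = 0 := by
    rw [gap_real_smul, Complex.re_ofReal_mul, h0, mul_zero]
  rw [gap, htr, mul_one, Complex.sub_re, Complex.ofReal_re, sub_eq_zero] at h
  exact (hK _ ⟨m, hm, B, _, hB, htr, rfl⟩ hy).ne h.symm

lemma dotProduct_compress_eq_gap {r : ℕ} (γ : Matrix (Fin r) (Fin n) ℂ)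
    (B : Matrix (Fin m) (Fin m) V) (x : Fin r × Fin m → ℂ) :
    star x ⬝ᵥ ((reM (compress γ ((a : ℂ) • Matrix.traceLinearMap (Fin n) ℂ ℂ -
        φ.toLinearMap ∘ₗ LinearMap.inl ℂ _ _) 1) ⊗ₖ (1 : Matrix (Fin m) (Fin m) ℂ) -
      reM (amplify (compress γ (φ.toLinearMap ∘ₗ LinearMap.inr ℂ _ _)) B)) *ᵥ x) =
      ((gap φ a B ((Matrix.of fun k p => x (p, k)) * γ)).re : ℂ) := by
  rw [← reM_kronecker_one, ← reM_sub, dotProduct_reM_mulVec, Matrix.sub_mulVec, dotProduct_sub,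
    ← amplify_matrix_one, dotProduct_amplify_compress, dotProduct_amplify_compress,
    mconj_matrix_one, gap]
  have h (X : Matrix (Fin n) (Fin n) ℂ) (Y : Matrix (Fin n) (Fin n) V) :
      φ (X, Y) = φ (X, 0) + φ (0, Y) := by
    rw [← map_add]; simp
  rw [h]
  simp [sub_sub]

end Exposure

section Statements

variable {E F' : Type*} [AddCommGroup E] [Module ℂ E] [AddCommGroup F'] [Module ℂ F']
theorem gammaExposedFace_implies_weakMatrixExposedFace
    (p : E →ₗ[ℂ] F' →ₗ[ℂ] ℂ)
    (K : ∀ n : ℕ, Set (Matrix (Fin n) (Fin n) (WeakBilin p)))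
    (hK : IsMatrixConvex K)
    (r n : ℕ) (hr : 0 < r) (hn : 0 < n)
    (F : Set (Matrix (Fin r) (Fin r) (WeakBilin p)))
    (hFsub : F ⊆ K r) (hFconv : Convex ℝ F)
    (γ : Matrix (Fin r) (Fin n) ℂ) (hγ : Function.Surjective γ.mulVec)
    (htr : (γᴴ * γ).trace = 1)
    (hexp : IsExposedFaceOf (GammaSet K n)
      ((fun A => (γᴴ * γ, mconj γ A)) '' F)) :
    IsWeakMatrixExposedFace K F := by
  obtain ⟨-, φ, a, hS, hlt⟩ := hexp
  obtain ⟨η, hη⟩ := Matrix.mulVec_surjective_iff_exists_right_inverse.1 hγ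
  have hη' : ηᴴ * γᴴ = 1 := by rw [← Matrix.conjTranspose_mul, hη, Matrix.conjTranspose_one]
  set f : Matrix (Fin n) (Fin n) (WeakBilin p) →ₗ[ℂ] ℂ :=
    φ.toLinearMap ∘ₗ LinearMap.inr ℂ _ _ with hf
  set β : Matrix (Fin r) (Fin r) ℂ := compress γ ((a : ℂ) • Matrix.traceLinearMap (Fin n) ℂ ℂ -
    φ.toLinearMap ∘ₗ LinearMap.inl ℂ _ _) 1 with hβ
  have hfc : Continuous f := φ.continuous.comp (continuous_const.prodMk continuous_id)
  have hpsd (m : ℕ) (hm : 0 < m) (B) (hB : B ∈ K m) :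
      (reM β ⊗ₖ (1 : Matrix (Fin m) (Fin m) ℂ) - reM (amplify (compress γ f) B)).PosSemidef := by
    refine .of_dotProduct_mulVec_nonneg ?_ fun x => ?_
    · rw [← reM_kronecker_one, ← reM_sub]
      exact reM_isHermitian _
    · rw [dotProduct_compress_eq_gap]
      exact_mod_cast gap_re_nonneg hS hlt hm hB _
  have hsing (m : ℕ) (hm : 0 < m) (B) (hB : B ∈ K m)
      (h : ¬ (reM β ⊗ₖ (1 : Matrix (Fin m) (Fin m) ℂ) -
        reM (amplify (compress γ f) B)).PosDef) :
      ∃ ε : Matrix (Fin m) (Fin r) ℂ, εᴴ * ε = 1 ∧ mconj ε B ∈ F := by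
    obtain ⟨x, hx, h0⟩ := (hpsd m hm B hB).exists_dotProduct_mulVec_eq_zero h
    rw [dotProduct_compress_eq_gap, Complex.ofReal_eq_zero] at h0
    have hδ : (Matrix.of fun k p => x (p, k)) * γ ≠ 0 := fun hδ => hx <| by
      have := congrArg (· * η) hδ
      simp only [Matrix.mul_assoc, hη, Matrix.mul_one, Matrix.zero_mul] at this
      ext ⟨p, k⟩
      exact congrFun (congrFun this k) p
    obtain ⟨c, A, hA, hc⟩ := exists_smul_mem_of_gap_re_eq_zero hlt hm hB hδ h0
    rw [← Matrix.smul_mul] at hc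
    set ε := c • (Matrix.of fun k p => x (p, k))
    obtain ⟨h1, h2⟩ := Prod.mk.inj hc
    refine ⟨ε, ?_, ?_⟩
    · have := congrArg (fun X => ηᴴ * X * η) h1
      simp only [Matrix.conjTranspose_mul, Matrix.mul_assoc, hη, Matrix.mul_one] at this
      simpa only [← Matrix.mul_assoc, hη', Matrix.one_mul] using this.symm
    · have := congrArg (mconj η) h2
      simp only [mconj_mconj, Matrix.mul_assoc, hη, Matrix.mul_one, mconj_one_left] at this
      exact this ▸ hA
  refine ⟨hFsub, hFconv, ⟨compress γ f, continuous_compress γ hfc⟩, reM β, reM_isHermitian _,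
    hpsd, fun m hm hmr B hB => by_contra fun h => ?_, Set.ext fun B => ⟨?_, ?_⟩⟩
  · obtain ⟨ε, hε, -⟩ := hsing m hm B hB h
    have h1 := Matrix.rank_mul_le_right εᴴ ε
    rw [hε, Matrix.rank_one, Fintype.card_fin] at h1
    have h2 := Matrix.rank_le_height ε
    omega
  · rintro ⟨hB, hB0, hB1⟩
    obtain ⟨ε, hε, hF⟩ := hsing r hr B hB fun h => hB1 h.isUnit
    have hε' : ε * εᴴ = 1 := mul_eq_one_comm.1 hε
    refine ⟨_, hF, εᴴ, Matrix.mem_unitaryGroup_iff.2 ?_, ?_⟩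
    · rw [Matrix.star_eq_conjTranspose, Matrix.conjTranspose_conjTranspose, hε]
    · rw [mconj_mconj, hε', mconj_one_left]
  · rintro ⟨A, hA, U, hU, rfl⟩
    have hU1 : Uᴴ * U = 1 := Matrix.mem_unitaryGroup_iff'.1 hU
    have hU2 : U * Uᴴ = 1 := Matrix.mem_unitaryGroup_iff.1 hU
    have hB := hK.mconj_mem hr (hFsub hA) hU1
    refine ⟨hB, hpsd r hr _ hB, fun hu => ?_⟩
    have hpd := (hpsd r hr _ hB).posDef_iff_isUnit.2 hu
    let x : Fin r × Fin r → ℂ := fun y => Uᴴ y.2 y.1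
    have hx : (Matrix.of fun k p => x (p, k)) = Uᴴ := rfl
    have hx0 : x ≠ 0 := fun h => by
      have hz : Uᴴ = 0 := by rw [← hx, h]; rfl
      rw [hz, Matrix.zero_mul] at hU1
      have : Nonempty (Fin r) := ⟨⟨0, hr⟩⟩
      exact zero_ne_one hU1
    refine (hpd.dotProduct_mulVec_pos hx0).ne' ?_
    have h1 : (Uᴴ * γ)ᴴ * (Uᴴ * γ) = γᴴ * γ := by
      rw [Matrix.conjTranspose_mul, Matrix.conjTranspose_conjTranspose, Matrix.mul_assoc,
        ← Matrix.mul_assoc U, hU2, Matrix.one_mul]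
    have h2 : mconj (Uᴴ * γ) (mconj U A) = mconj γ A := by
      rw [mconj_mconj, ← Matrix.mul_assoc, hU2, Matrix.one_mul]
    have h3 := hS _ ⟨A, hA, rfl⟩
    refine (dotProduct_compress_eq_gap γ (mconj U A) x).trans ?_
    rw [hx, gap, h1, h2, htr, mul_one, Complex.sub_re, h3, Complex.ofReal_re, sub_self,
      Complex.ofReal_zero]

end Statements
end

section
/- Let K = (K_n)_{n≥1} be a matrix convex set in V and let F = (F_n)_{n≥1} be a matrix exposed multiface of K. Then for every n ≥ 1, the component F_n is an exposed face of the convex set K_n ⊆ M_n(V). -/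
open scoped Matrix Kronecker ComplexOrder

/-- A nonempty convex set of singular positive semidefinite matrices has a common
nonzero kernel vector. -/
theorem exists_common_mulVec_eq_zero {ι : Type*} [Fintype ι] [DecidableEq ι]
    {S : Set (Matrix ι ι ℂ)} (hne : S.Nonempty) (hconv : Convex ℝ S)
    (hpsd : ∀ A ∈ S, A.PosSemidef) (hsing : ∀ A ∈ S, ¬ IsUnit A) :
    ∃ v : ι → ℂ, v ≠ 0 ∧ ∀ A ∈ S, A *ᵥ v = 0 := by
  obtain ⟨_, ⟨A, hA, rfl⟩, hmin⟩ := IsArtinian.set_has_minimal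
    ((fun A : Matrix ι ι ℂ => LinearMap.ker A.mulVecLin) '' S) (hne.image _)
  obtain ⟨v, hv0, hv⟩ : ∃ v : ι → ℂ, v ≠ 0 ∧ A *ᵥ v = 0 := by
    rw [Matrix.exists_mulVec_eq_zero_iff]
    by_contra h
    exact hsing A hA ((Matrix.isUnit_iff_isUnit_det A).2 (isUnit_iff_ne_zero.2 h))
  refine ⟨v, hv0, fun B hB => ?_⟩
  set C : Matrix ι ι ℂ := (1 / 2 : ℝ) • A + (1 / 2 : ℝ) • B with hCdef
  have hC : C ∈ S := hconv hA hB (by norm_num) (by norm_num) (by norm_num)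
  have hker : ∀ w : ι → ℂ, C *ᵥ w = 0 → A *ᵥ w = 0 ∧ B *ᵥ w = 0 := by
    intro w hw
    have hnA := (hpsd A hA).dotProduct_mulVec_nonneg w
    have hnB := (hpsd B hB).dotProduct_mulVec_nonneg w
    have hsum : star w ⬝ᵥ A *ᵥ w + star w ⬝ᵥ B *ᵥ w = 0 := by
      have h : star w ⬝ᵥ C *ᵥ w = 0 := by rw [hw, dotProduct_zero]
      rw [hCdef, Matrix.add_mulVec, Matrix.smul_mulVec, Matrix.smul_mulVec, dotProduct_add,
        dotProduct_smul, dotProduct_smul, ← smul_add] at h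
      exact (smul_eq_zero.1 h).resolve_left (by norm_num)
    obtain ⟨h1, h2⟩ := (add_eq_zero_iff_of_nonneg hnA hnB).1 hsum
    exact ⟨((hpsd A hA).dotProduct_mulVec_zero_iff w).1 h1,
      ((hpsd B hB).dotProduct_mulVec_zero_iff w).1 h2⟩
  have hle : LinearMap.ker C.mulVecLin ≤ LinearMap.ker A.mulVecLin := fun w hw =>
    (hker w hw).1
  have heq := eq_of_le_of_not_lt hle (hmin _ ⟨C, hC, rfl⟩)
  have hvC : v ∈ LinearMap.ker C.mulVecLin := heq ▸ (show v ∈ LinearMap.ker A.mulVecLin from hv)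
  exact (hker v hvC).2

/-- The Hermitian part of a matrix has the real part of its quadratic form. -/
theorem re_star_dotProduct_reM_mulVec {ι : Type*} [Fintype ι] (X : Matrix ι ι ℂ) (v : ι → ℂ) :
    (star v ⬝ᵥ reM X *ᵥ v).re = (star v ⬝ᵥ X *ᵥ v).re := by
  have h : star v ⬝ᵥ Xᴴ *ᵥ v = star (star v ⬝ᵥ X *ᵥ v) := by
    rw [Matrix.star_dotProduct, Matrix.star_mulVec, ← Matrix.dotProduct_mulVec,
      Matrix.conjTranspose_conjTranspose]
  rw [reM, Matrix.smul_mulVec, Matrix.add_mulVec, dotProduct_smul, dotProduct_add, h]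
  simp
  ring

/-- The vector functional `B ↦ v* Φ_n(B) v`. -/
noncomputable def amplifyForm {V : Type*} [AddCommGroup V] [Module ℂ V] [TopologicalSpace V]
    {r n : ℕ} (Φ : V →L[ℂ] Matrix (Fin r) (Fin r) ℂ) (v : Fin r × Fin n → ℂ) :
    Matrix (Fin n) (Fin n) V →L[ℂ] ℂ where
  toFun B := star v ⬝ᵥ amplify Φ B *ᵥ v
  map_add' A B := by
    rw [← dotProduct_add, ← Matrix.add_mulVec]
    congr 2
    ext i j
    simp [amplify]
  map_smul' c B := by
    rw [RingHom.id_apply, ← dotProduct_smul, ← Matrix.smul_mulVec]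
    congr 2
    ext i j
    simp [amplify]
  cont := by
    have h : ∀ i j : Fin r × Fin n,
        Continuous fun B : Matrix (Fin n) (Fin n) V => Φ (B i.2 j.2) i.1 j.1 := fun i j =>
      (Φ.continuous.comp (continuous_id.matrix_elem i.2 j.2)).matrix_elem i.1 j.1
    exact continuous_finsetSum _ fun i _ => continuous_const.mul <|
      continuous_finsetSum _ fun j _ => (h i j).mul continuous_const

/-- The affine pencil `B ↦ α ⊗ I - Re Φ_n(B)` respects real convex combinations. -/
theorem pencil_convexCombination {V : Type*} [AddCommGroup V] [Module ℂ V] [TopologicalSpace V]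
    {r n : ℕ} (Φ : V →L[ℂ] Matrix (Fin r) (Fin r) ℂ) (X : Matrix (Fin r × Fin n) (Fin r × Fin n) ℂ)
    (A B : Matrix (Fin n) (Fin n) V) {a b : ℝ} (hab : a + b = 1) :
    X - reM (amplify Φ (a • A + b • B)) =
      a • (X - reM (amplify Φ A)) + b • (X - reM (amplify Φ B)) := by
  have hX : X = a • X + b • X := by rw [← add_smul, hab, one_smul]
  have hR : reM (amplify Φ (a • A + b • B)) =
      a • reM (amplify Φ A) + b • reM (amplify Φ B) := by
    ext i j
    have hs : ∀ (c : ℝ) (x : V), Φ (c • x) = (c : ℂ) • Φ x := fun c x => Φ.map_smul (c : ℂ) x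
    simp [reM, amplify, hs]
    ring
  rw [hR, smul_sub, smul_sub]
  nth_rewrite 1 [hX]
  abel

/-- Components of a matrix exposed multiface are exposed faces, for any topology on the
underlying vector space. -/
theorem IsMatrixExposedMultiface.isExposedFaceOf {V : Type*} [AddCommGroup V] [Module ℂ V]
    [TopologicalSpace V] {K F : ∀ n : ℕ, Set (Matrix (Fin n) (Fin n) V)}
    (hF : IsMatrixExposedMultiface K F) {n : ℕ} (hn : 0 < n) :
    IsExposedFaceOf (K n) (F n) := by
  obtain ⟨hsub, hconv, r, -, Φ, α, -, hpsd, hface⟩ := hF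
  refine ⟨hsub n, ?_⟩
  rcases (F n).eq_empty_or_nonempty with hempty | hne
  · exact ⟨0, 1, by simp [hempty], fun y _ _ => by simp⟩
  set L : Matrix (Fin n) (Fin n) V → Matrix (Fin r × Fin n) (Fin r × Fin n) ℂ :=
    fun B => α ⊗ₖ (1 : Matrix (Fin n) (Fin n) ℂ) - reM (amplify Φ B) with hL
  have hmem : ∀ B, B ∈ F n ↔ B ∈ K n ∧ (L B).PosSemidef ∧ ¬ IsUnit (L B) := fun B => by
    rw [← hface n hn]; rfl
  obtain ⟨v, hv0, hv⟩ := exists_common_mulVec_eq_zero (S := L '' F n) (hne.image L)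
    (by
      rintro _ ⟨A, hA, rfl⟩ _ ⟨B, hB, rfl⟩ a b ha hb hab
      exact ⟨_, hconv n hA hB ha hb hab, pencil_convexCombination Φ _ A B hab⟩)
    (by rintro _ ⟨B, hB, rfl⟩; exact ((hmem B).1 hB).2.1)
    (by rintro _ ⟨B, hB, rfl⟩; exact ((hmem B).1 hB).2.2)
  have hre : ∀ B, (star v ⬝ᵥ L B *ᵥ v).re =
      (star v ⬝ᵥ (α ⊗ₖ (1 : Matrix (Fin n) (Fin n) ℂ)) *ᵥ v).re - (amplifyForm Φ v B).re := by
    intro B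
    rw [hL, Matrix.sub_mulVec, dotProduct_sub, Complex.sub_re, re_star_dotProduct_reM_mulVec]
    rfl
  refine ⟨amplifyForm Φ v, (star v ⬝ᵥ (α ⊗ₖ (1 : Matrix (Fin n) (Fin n) ℂ)) *ᵥ v).re,
    fun B hB => ?_, fun B hB hBF => ?_⟩
  · have h := hre B
    rw [hv _ ⟨B, hB, rfl⟩, dotProduct_zero, Complex.zero_re] at h
    linarith
  · have hB' := hpsd n hn B hB
    have hu : IsUnit (L B) := by
      by_contra h
      exact hBF ((hmem B).2 ⟨hB, hB', h⟩)
    have hpos := (hB'.posDef_iff_isUnit.2 hu).dotProduct_mulVec_pos hv0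
    have h := (Complex.pos_iff.1 hpos).1
    have h2 := hre B
    simp only [hL] at h2
    linarith

section Statements

variable {E F' : Type*} [AddCommGroup E] [Module ℂ E] [AddCommGroup F'] [Module ℂ F']
theorem matrixExposedMultiface_components_are_exposedFaces
    (p : E →ₗ[ℂ] F' →ₗ[ℂ] ℂ)
    (K F : ∀ n : ℕ, Set (Matrix (Fin n) (Fin n) (WeakBilin p)))
    (hK : IsMatrixConvex K) (hF : IsMatrixExposedMultiface K F) :
    ∀ n : ℕ, 0 < n → IsExposedFaceOf (K n) (F n) := by
  exact fun n hn => hF.isExposedFaceOf hn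

end Statements
end
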